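/- For all integers n, r, k with k ≥ r + 3 ≥ 6, every r-uniform hypergraph on n vertices containing no Berge-cycle of length at least k has at most ((n−1)/(k−2))·C(k−1, r) hyperedges. -/

import Mathlib

open scoped Classical

/-- A Berge-path of length `t` in the hypergraph `H` (a family of hyperedges):
an alternating sequence of `t+1` distinct vertices and `t` distinct hyperedges
`v₁, e₁, …, e_t, v_{t+1}` with `vᵢ, vᵢ₊₁ ∈ eᵢ`. -/
structure BergePath {V : Type*} (H : Finset (Finset V)) (t : ℕ) where
  verts : Fin (t + 1) → V
  edges : Fin t → Finset V
  verts_inj : Function.Injective verts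
  edges_inj : Function.Injective edges
  edges_mem : ∀ i, edges i ∈ H
  fst_mem : ∀ i : Fin t, verts i.castSucc ∈ edges i
  snd_mem : ∀ i : Fin t, verts i.succ ∈ edges i

/-- A Berge-cycle of length `t` in the hypergraph `H`: `t` distinct vertices and
`t` distinct hyperedges with `vᵢ, vᵢ₊₁ ∈ eᵢ`, indices mod `t`. -/
structure BergeCycle {V : Type*} (H : Finset (Finset V)) (t : ℕ) where
  verts : Fin t → V
  edges : Fin t → Finset V
  verts_inj : Function.Injective verts
  edges_inj : Function.Injective edges
  edges_mem : ∀ i, edges i ∈ H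
  fst_mem : ∀ i, verts i ∈ edges i
  snd_mem : ∀ i : Fin t, verts ⟨(i.val + 1) % t, Nat.mod_lt _ i.pos⟩ ∈ edges i

/-- `u` and `v` are joined by a Berge-path of `H`. -/
def BergeReachable {V : Type*} (H : Finset (Finset V)) (u v : V) : Prop :=
  ∃ t, ∃ P : BergePath H t, P.verts 0 = u ∧ P.verts (Fin.last t) = v

/-- A hypergraph on the vertex type `V` is connected if any two vertices are joined
by a Berge-path. -/
def HConnected {V : Type*} (H : Finset (Finset V)) : Prop :=
  ∀ u v : V, u ≠ v → BergeReachable H u v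

/-- The degree of a vertex: the number of hyperedges containing it. -/
noncomputable def hdeg {V : Type*} (H : Finset (Finset V)) (v : V) : ℕ :=
  (H.filter (fun e => v ∈ e)).card

/-- The vertex neighborhood of `v` in `H`. -/
noncomputable def nbhd {V : Type*} [Fintype V] (H : Finset (Finset V)) (v : V) : Finset V :=
  Finset.univ.filter (fun u => u ≠ v ∧ ∃ e ∈ H, v ∈ e ∧ u ∈ e)

/-- The sub-hypergraph induced by a set `S` of vertices: all hyperedges lying inside `S`. -/
noncomputable def restrictTo {V : Type*} (H : Finset (Finset V)) (S : Finset V) :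
    Finset (Finset V) :=
  H.filter (fun e => e ⊆ S)

/-- `DelProcess H D S T` : starting from the vertex set `S`, the vertex set `T` can be
reached by repeatedly deleting a vertex whose degree in the current induced
sub-hypergraph is less than `D` (together with all hyperedges containing it). -/
inductive DelProcess {V : Type*} (H : Finset (Finset V)) (D : ℕ) :
    Finset V → Finset V → Prop
  | refl (S : Finset V) : DelProcess H D S S
  | step (S T : Finset V) (v : V) (hv : v ∈ S)
      (hd : hdeg (restrictTo H S) v < D)
      (h : DelProcess H D (S.erase v) T) : DelProcess H D S T

/-- The edge family of `H_{n,k}` for odd `k`, on vertex set `S` with kernel `A`: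
all `r`-subsets of `S` having at most one vertex outside `A`. -/
noncomputable def HnkFamilyOdd {V : Type*} (r : ℕ) (S A : Finset V) : Finset (Finset V) :=
  S.powerset.filter (fun s => s.card = r ∧ (s \ A).card ≤ 1)

/-- The edge family of `H_{n,k}` for even `k`: additionally all `r`-subsets consisting of
`b1`, `b2` and `r-2` vertices of `A`. -/
noncomputable def HnkFamilyEven {V : Type*} (r : ℕ) (S A : Finset V) (b1 b2 : V) :
    Finset (Finset V) :=
  S.powerset.filter (fun s => s.card = r ∧ ((s \ A).card ≤ 1 ∨ s \ A = {b1, b2}))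

/-- `H` is (a copy of) the extremal hypergraph `H_{m,k}` on the vertex set `S`
(where `m = |S|`). Note that `⌊(k-1)/2⌋` equals `(k-1)/2` in ℕ for odd `k`,
and `(k-2)/2` for even `k`. -/
def IsHnkOn {V : Type*} (r k : ℕ) (S : Finset V) (H : Finset (Finset V)) : Prop :=
  ∃ A ⊆ S, A.card = (k - 1) / 2 ∧
    ((Odd k ∧ H = HnkFamilyOdd r S A) ∨
     (Even k ∧ ∃ b1 ∈ S \ A, ∃ b2 ∈ S \ A, b1 ≠ b2 ∧ H = HnkFamilyEven r S A b1 b2))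

/-- The extremal number of hyperedges:
`C(⌊(k-1)/2⌋, r-1)·(n − ⌊(k-1)/2⌋) + C(⌊(k-1)/2⌋, r) + [2 ∣ k]·C(⌊(k-1)/2⌋, r-2)`. -/
def extremalCount (r k n : ℕ) : ℕ :=
  ((k - 1) / 2).choose (r - 1) * (n - (k - 1) / 2) + ((k - 1) / 2).choose r +
    (if 2 ∣ k then ((k - 1) / 2).choose (r - 2) else 0)

/-- The threshold `N_{k,r}`. -/
def Nkr (r k : ℕ) : ℕ :=
  (r * (k - 1)).choose r + ((k - 1) / 2).choose (r - 1) * ((k - 1) / 2)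
    - ((k - 1) / 2).choose r - (if 2 ∣ k then ((k - 1) / 2).choose (r - 2) else 0)
    + r * (k - 1)

theorem le_choose_of_lt {n j : ℕ} (hj : 1 ≤ j) (hjn : j < n) : n ≤ n.choose j := by
  induction n generalizing j with
  | zero => omega
  | succ n ih =>
    obtain ⟨i, rfl⟩ : ∃ i, j = i + 1 := ⟨j - 1, by omega⟩
    rw [Nat.choose_succ_succ']
    have hpos : 1 ≤ n.choose i := Nat.choose_pos (by omega)
    rcases Nat.lt_or_ge (i + 1) n with h | h
    · have := ih hj h
      omega
    · obtain rfl : n = i + 1 := by omega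
      simp [Nat.choose_succ_self_right]

theorem choose_two_le_choose {n j : ℕ} (hj : 2 ≤ j) (hjn : j + 2 ≤ n) :
    n.choose 2 ≤ n.choose j := by
  induction n generalizing j with
  | zero => omega
  | succ n ih =>
    rcases Nat.lt_or_ge (j + 1) n with h | h
    · obtain ⟨i, rfl⟩ : ∃ i, j = i + 1 := ⟨j - 1, by omega⟩
      rw [Nat.choose_succ_succ, Nat.choose_succ_succ]
      have h1 := ih hj (by omega)
      have h2 : n ≤ n.choose i := le_choose_of_lt (by omega) (by omega)
      simpa using Nat.add_le_add h2 h1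
    · obtain rfl : n = j + 1 := by omega
      exact (Nat.choose_symm_of_eq_add (by ring)).le

/-- The forward differences of `g` are nondecreasing. -/
def DiscreteConvex (g : ℕ → ℚ) : Prop :=
  ∀ x, g (x + 1) - g x ≤ g (x + 2) - g (x + 1)

namespace DiscreteConvex

variable {g : ℕ → ℚ}

theorem diff_mono (hg : DiscreteConvex g) {x y : ℕ} (hxy : x ≤ y) :
    g (x + 1) - g x ≤ g (y + 1) - g y :=
  monotone_nat_of_le_succ (f := fun x => g (x + 1) - g x) hg hxy

theorem le_max (hg : DiscreteConvex g) (h0 : g 0 = 0) {y z : ℕ} (hyz : y ≤ z) :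
    g y ≤ max 0 (g z) := by
  induction z, hyz using Nat.le_induction with
  | base => exact le_max_right _ _
  | succ z hyz ih =>
    by_cases h : g z ≤ g (z + 1)
    · exact ih.trans (max_le_max le_rfl h)
    · push Not at h
      have hanti : ∀ x, x ≤ z → g x ≤ 0 := by
        intro x
        induction x with
        | zero => intro _; exact h0.le
        | succ x ihx =>
          intro hx
          have h1 := ihx (by omega)
          have h2 := hg.diff_mono (show x ≤ z by omega)
          linarith
      exact (hanti y hyz).trans (le_max_left _ _)

theorem add_reflect_le (hg : DiscreteConvex g) {b x N : ℕ} (hbx : b ≤ x) (hx : x + b ≤ N) :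
    g x + g (N - x) ≤ g b + g (N - b) := by
  wlog h : 2 * x ≤ N generalizing x
  · have := this (x := N - x) (by omega) (by omega) (by omega)
    rw [Nat.sub_sub_self (by omega : x ≤ N)] at this
    linarith
  induction x, hbx using Nat.le_induction with
  | base => exact le_rfl
  | succ x hbx ih =>
    have h1 := ih (by omega) (by omega)
    have h2 := hg.diff_mono (show x ≤ N - (x + 1) by omega)
    rw [show N - (x + 1) + 1 = N - x by omega] at h2
    linarith

/-- The average of `g` over `[b, N - b]` is at most its average over `[1, N - 1]`. -/
theorem sum_symm_le (hg : DiscreteConvex g) {N b : ℕ} {M : ℚ} (hb : 1 ≤ b) (hbN : 2 * b ≤ N)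
    (hM : ∑ x ∈ Finset.Ico 1 N, g x ≤ ((N : ℚ) - 1) * M) :
    ∑ x ∈ Finset.Ico b (N - b + 1), g x ≤ ((N : ℚ) - 2 * b + 1) * M := by
  induction b, hb using Nat.le_induction with
  | base =>
    rw [show N - 1 + 1 = N by omega]
    push_cast
    linarith
  | succ b hb ih =>
    have ih := ih (by omega)
    rw [Finset.sum_eq_sum_Ico_succ_bot (by omega), show N - b + 1 = (N - b) + 1 from rfl,
      Finset.sum_Ico_succ_top (by omega), show N - b = N - (b + 1) + 1 by omega] at ih
    rw [show N - (b + 1) + 1 = N - b by omega] at ih ⊢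
    by_cases h : 2 * M ≤ g b + g (N - b)
    · push_cast
      linarith
    · push Not at h
      have hrefl : ∑ x ∈ Finset.Ico (b + 1) (N - b), g (N - x)
          = ∑ x ∈ Finset.Ico (b + 1) (N - b), g x := by
        refine Finset.sum_bij' (fun x _ => N - x) (fun x _ => N - x) ?_ ?_ ?_ ?_ ?_ <;>
          simp only [Finset.mem_Ico] <;> intros <;> first | omega | trivial
      have hle : ∑ x ∈ Finset.Ico (b + 1) (N - b), (g x + g (N - x))
          ≤ ∑ x ∈ Finset.Ico (b + 1) (N - b), 2 * M := by
        refine Finset.sum_le_sum fun x hx => ?_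
        rw [Finset.mem_Ico] at hx
        exact (hg.add_reflect_le (by omega) (by omega)).trans h.le
      rw [Finset.sum_add_distrib, hrefl, Finset.sum_const, Nat.card_Ico, nsmul_eq_mul,
        Nat.cast_sub (by omega), Nat.cast_sub (by omega)] at hle
      push_cast at hle ⊢
      linarith

theorem sum_Ico_le (hg : DiscreteConvex g) (h0 : g 0 = 0) {N b c : ℕ} {M : ℚ} (hM0 : 0 ≤ M)
    (hb : 1 ≤ b) (hbc : b ≤ c) (hbN : b + c ≤ N)
    (hM : ∑ x ∈ Finset.Ico 1 N, g x ≤ ((N : ℚ) - 1) * M) :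
    ∑ x ∈ Finset.Ico b (c + 1), g x ≤ ((c : ℚ) - b + 1) * M := by
  have hcN : c ≤ N - b := by omega
  induction hcN using Nat.decreasingInduction with
  | self =>
    have := hg.sum_symm_le hb (by omega) hM
    rw [Nat.cast_sub (by omega)]
    linarith
  | of_succ c hc ih =>
    have ih := ih (by omega) (by omega)
    rw [Finset.sum_Ico_succ_top (by omega)] at ih
    push_cast at ih
    by_cases h : M ≤ g (c + 1)
    · linarith
    · push Not at h
      have hle : ∑ x ∈ Finset.Ico b (c + 1), g x ≤ ∑ x ∈ Finset.Ico b (c + 1), M := by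
        refine Finset.sum_le_sum fun x hx => ?_
        rw [Finset.mem_Ico] at hx
        exact (hg.le_max h0 hx.2.le).trans (max_le hM0 h.le)
      rw [Finset.sum_const, Nat.card_Ico, nsmul_eq_mul, Nat.cast_sub (by omega)] at hle
      push_cast at hle
      linarith

theorem sum_Ico_le_of_le (hg : DiscreteConvex g) (h0 : g 0 = 0) {N b c : ℕ} {M : ℚ} (hM0 : 0 ≤ M)
    (hbc : b ≤ c) (hbN : b + c ≤ N) (hcN : c + 1 ≤ N)
    (hM : ∑ x ∈ Finset.Ico 1 N, g x ≤ ((N : ℚ) - 1) * M) :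
    ∑ x ∈ Finset.Ico b (c + 1), g x ≤ ((c : ℚ) - b + 1) * M := by
  rcases Nat.eq_zero_or_pos b with rfl | hb
  · rw [Finset.sum_eq_sum_Ico_succ_bot (by omega), h0, zero_add]
    rcases Nat.eq_zero_or_pos c with rfl | hc
    · simpa using hM0
    · have := hg.sum_Ico_le h0 hM0 le_rfl hc (by omega) hM
      push_cast at this ⊢
      linarith
  · exact hg.sum_Ico_le h0 hM0 hb hbc hbN hM

end DiscreteConvex

theorem sum_Ico_choose {b c : ℕ} (hbc : b ≤ c) (j : ℕ) :
    ∑ x ∈ Finset.Ico b c, (x.choose j : ℚ) = c.choose (j + 1) - b.choose (j + 1) := by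
  induction c, hbc using Nat.le_induction with
  | base => simp
  | succ c hbc ih =>
    rw [Finset.sum_Ico_succ_top hbc, ih, Nat.choose_succ_succ]
    push_cast
    ring

theorem discreteConvex_choose_sub_id (j : ℕ) :
    DiscreteConvex fun x => (x.choose (j + 1) : ℚ) - x := by
  intro x
  have h : ((x.choose j : ℕ) : ℚ) ≤ ((x + 1).choose j : ℕ) := by
    exact_mod_cast Nat.choose_le_choose j (Nat.le_succ x)
  simp only [Nat.choose_succ_succ (x + 1) j, Nat.choose_succ_succ x j]
  push_cast
  linarith

/-- The number of `m`-subsets of an `(a + 1) + b`-set meeting the part of size `a + 1`, divided by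
`a + 1`. -/
def meetShare (m a b : ℕ) : ℚ :=
  (((a + b + 1).choose m : ℚ) - b.choose m) / (a + 1)

theorem meetShare_two (a b : ℕ) : meetShare 2 a b = b + a / 2 := by
  have h : (a : ℚ) + 1 ≠ 0 := by positivity
  rw [meetShare, Nat.cast_choose_two, Nat.cast_choose_two, div_eq_iff h]
  push_cast
  ring

theorem meetShare_add_meetShare_le {r N a b a' b' : ℕ} (hr : 3 ≤ r) (hrN : r + 2 ≤ N)
    (h₁ : a + a' + 2 ≤ N) (h₂ : a + a' + 2 * (b + b') ≤ N) :
    ((N : ℚ) - 1) * (meetShare r a b + meetShare 2 a' b') ≤ N.choose r := by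
  obtain ⟨j, rfl⟩ : ∃ j, r = j + 1 + 1 := ⟨r - 2, by omega⟩
  have hN : (0 : ℚ) < (N : ℚ) - 1 := by
    have : (7 : ℚ) ≤ N + 2 := by exact_mod_cast (by omega)
    linarith
  set M : ℚ := ((N.choose (j + 1 + 1) : ℚ) - N.choose 2) / (N - 1) with hMdef
  have hM0 : 0 ≤ M := by
    have : ((N.choose 2 : ℕ) : ℚ) ≤ (N.choose (j + 1 + 1) : ℕ) := by
      exact_mod_cast choose_two_le_choose (by omega) hrN
    exact div_nonneg (by linarith) hN.le
  have hMN : ((N : ℚ) - 1) * M = N.choose (j + 1 + 1) - N.choose 2 := by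
    rw [hMdef]; field_simp
  have hsum : ∀ {b c : ℕ}, b ≤ c →
      ∑ x ∈ Finset.Ico b c, ((x.choose (j + 1) : ℚ) - x)
        = (c.choose (j + 1 + 1) - b.choose (j + 1 + 1)) - (c.choose 2 - b.choose 2) := by
    intro b c hbc
    rw [Finset.sum_sub_distrib, sum_Ico_choose hbc]
    have := sum_Ico_choose hbc 1
    simp only [Nat.choose_one_right] at this
    rw [this]
  have key := (discreteConvex_choose_sub_id j).sum_Ico_le_of_le (by simp) hM0
    (show b ≤ a + b by omega) (show b + (a + b) ≤ N by omega) (by omega)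
    (by rw [hsum (by omega), hMN, Nat.choose_eq_zero_of_lt (by omega : 1 < j + 1 + 1)]; simp)
  rw [hsum (by omega)] at key
  have ha : (0 : ℚ) < (a : ℚ) + 1 := by positivity
  have hblue : meetShare (j + 1 + 1) a b ≤ M + meetShare 2 a b := by
    rw [meetShare, meetShare, div_le_iff₀ ha, add_mul, div_mul_cancel₀ _ ha.ne']
    push_cast at key
    linarith
  rw [meetShare_two] at hblue ⊢
  have h2 : (a : ℚ) + a' + 2 * (b + b') ≤ N := by exact_mod_cast h₂
  have htot : meetShare (j + 1 + 1) a b + (b' + a' / 2) ≤ M + N / 2 := by linarith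
  calc _ ≤ ((N : ℚ) - 1) * (M + N / 2) := mul_le_mul_of_nonneg_left htot hN.le
    _ = N.choose (j + 1 + 1) := by
      rw [mul_add, hMN, Nat.cast_choose_two]
      ring

section Counting

variable {V : Type*}

theorem sum_sum_inv_card_inter (F : Finset (Finset V)) (D : Finset V) :
    ∑ v ∈ D, ∑ Q ∈ F with v ∈ Q, ((Q ∩ D).card : ℚ)⁻¹
      = ({Q ∈ F | ¬ Disjoint Q D} : Finset (Finset V)).card := by
  simp_rw [Finset.sum_filter]
  rw [Finset.sum_comm, Finset.card_filter, Nat.cast_sum]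
  refine Finset.sum_congr rfl fun Q _ => ?_
  rw [← Finset.sum_filter, Finset.sum_const, Finset.filter_mem_eq_inter, Finset.inter_comm D Q,
    nsmul_eq_mul]
  split_ifs with h
  · rw [Finset.disjoint_iff_inter_eq_empty] at h
    simp [h]
  · rw [Finset.disjoint_iff_inter_eq_empty] at h
    rw [mul_inv_cancel₀ (by simpa using h), Nat.cast_one]

theorem sum_inv_card_inter_powersetCard {A B : Finset V} (hAB : Disjoint A B) {v : V} (hv : v ∈ A)
    (m : ℕ) :
    (A.card : ℚ) * ∑ Q ∈ (A ∪ B).powersetCard m with v ∈ Q, ((Q ∩ A).card : ℚ)⁻¹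
      = (A.card + B.card).choose m - B.card.choose m := by
  have hsymm : ∀ u ∈ A, ∑ Q ∈ (A ∪ B).powersetCard m with u ∈ Q, ((Q ∩ A).card : ℚ)⁻¹
      = ∑ Q ∈ (A ∪ B).powersetCard m with v ∈ Q, ((Q ∩ A).card : ℚ)⁻¹ := by
    intro u hu
    have hmap : ∀ {s : Finset V}, u ∈ s → v ∈ s → s.map (Equiv.swap u v).toEmbedding = s := by
      intro s hus hvs
      refine Finset.eq_of_subset_of_card_le ?_ (by simp)
      intro x hx
      obtain ⟨y, hy, rfl⟩ := Finset.mem_map.1 hx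
      simp only [Equiv.coe_toEmbedding, Equiv.swap_apply_def]
      split_ifs <;> assumption
    have hAB' := hmap (Finset.mem_union_left B hu) (Finset.mem_union_left B hv)
    have hinv : ∀ s : Finset V,
        (s.map (Equiv.swap u v).toEmbedding).map (Equiv.swap u v).toEmbedding = s := by
      intro s
      ext x
      simp
    have hmem : ∀ s ∈ (A ∪ B).powersetCard m,
        s.map (Equiv.swap u v).toEmbedding ∈ (A ∪ B).powersetCard m := by
      intro s hs
      rw [Finset.mem_powersetCard] at hs ⊢
      refine ⟨?_, by simpa using hs.2⟩
      rw [← hAB']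
      exact Finset.map_subset_map.2 hs.1
    refine Finset.sum_bij' (fun Q _ => Q.map (Equiv.swap u v).toEmbedding)
      (fun Q _ => Q.map (Equiv.swap u v).toEmbedding) ?_ ?_ (fun Q _ => hinv Q)
      (fun Q _ => hinv Q) ?_
    · intro Q hQ
      rw [Finset.mem_filter] at hQ ⊢
      exact ⟨hmem Q hQ.1, Finset.mem_map.2 ⟨u, hQ.2, by simp⟩⟩
    · intro Q hQ
      rw [Finset.mem_filter] at hQ ⊢
      exact ⟨hmem Q hQ.1, Finset.mem_map.2 ⟨v, hQ.2, by simp⟩⟩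
    · intro Q _
      congr 2
      conv_rhs => rw [← hmap hu hv, ← Finset.map_inter, Finset.card_map]
  have htotal := sum_sum_inv_card_inter ((A ∪ B).powersetCard m) A
  rw [Finset.sum_congr rfl hsymm, Finset.sum_const, nsmul_eq_mul] at htotal
  rw [htotal]
  have hcompl : ({Q ∈ (A ∪ B).powersetCard m | Disjoint Q A} : Finset (Finset V))
      = B.powersetCard m := by
    ext Q
    simp only [Finset.mem_filter, Finset.mem_powersetCard]
    constructor
    · rintro ⟨⟨h1, h2⟩, h3⟩
      exact ⟨h3.left_le_of_le_sup_left h1, h2⟩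
    · rintro ⟨h1, h2⟩
      exact ⟨⟨h1.trans Finset.subset_union_right, h2⟩, (hAB.mono_right h1).symm⟩
  have hsplit := Finset.card_filter_add_card_filter_not (s := (A ∪ B).powersetCard m)
    (fun Q => Disjoint Q A)
  rw [hcompl, Finset.card_powersetCard, Finset.card_powersetCard,
    Finset.card_union_of_disjoint hAB] at hsplit
  rw [← hsplit]
  push_cast
  ring

/-- The cliques with `m` vertices of `Γ` inside `S`. -/
noncomputable def cliquesIn (Γ : SimpleGraph V) (m : ℕ) (S : Finset V) : Finset (Finset V) :=
  {Q ∈ S.powersetCard m | Γ.IsClique (Q : Set V)}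

/-- The neighbours of `v` in `Γ` inside `S`. -/
noncomputable def nbrsIn (Γ : SimpleGraph V) (S : Finset V) (v : V) : Finset V :=
  {u ∈ S | Γ.Adj v u}

theorem mem_cliquesIn {Γ : SimpleGraph V} {m : ℕ} {S Q : Finset V} :
    Q ∈ cliquesIn Γ m S ↔ (Q ⊆ S ∧ Q.card = m) ∧ Γ.IsClique (Q : Set V) := by
  rw [cliquesIn, Finset.mem_filter, Finset.mem_powersetCard]

theorem mem_nbrsIn {Γ : SimpleGraph V} {S : Finset V} {u v : V} :
    u ∈ nbrsIn Γ S v ↔ u ∈ S ∧ Γ.Adj v u := by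
  rw [nbrsIn, Finset.mem_filter]

theorem card_cliquesIn (Γ : SimpleGraph V) (m : ℕ) (S D : Finset V) :
    ((cliquesIn Γ m S).card : ℚ) = (cliquesIn Γ m (S \ D)).card
      + ∑ v ∈ D, ∑ Q ∈ cliquesIn Γ m S with v ∈ Q, ((Q ∩ D).card : ℚ)⁻¹ := by
  have hsdiff : cliquesIn Γ m (S \ D) = {Q ∈ cliquesIn Γ m S | Disjoint Q D} := by
    ext Q
    simp only [mem_cliquesIn, Finset.mem_filter, Finset.subset_sdiff]
    tauto
  rw [sum_sum_inv_card_inter, hsdiff]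
  exact_mod_cast (Finset.card_filter_add_card_filter_not _).symm

theorem sum_inv_card_inter_cliquesIn_le (Γ : SimpleGraph V) (m : ℕ) (S : Finset V) {D : Finset V}
    {v : V} (hv : v ∈ D) :
    ∑ Q ∈ cliquesIn Γ m S with v ∈ Q, ((Q ∩ D).card : ℚ)⁻¹
      ≤ meetShare m (nbrsIn Γ S v ∩ D).card (nbrsIn Γ S v \ D).card := by
  set A := insert v (nbrsIn Γ S v ∩ D) with hA
  set B := nbrsIn Γ S v \ D
  have hvN : v ∉ nbrsIn Γ S v := fun h => Γ.loopless.irrefl v (mem_nbrsIn.1 h).2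
  have hAcard : A.card = (nbrsIn Γ S v ∩ D).card + 1 :=
    Finset.card_insert_of_notMem fun h => hvN (Finset.mem_inter.1 h).1
  have hAD : A ⊆ D := Finset.insert_subset hv Finset.inter_subset_right
  have hAB : Disjoint A B := Finset.disjoint_sdiff.mono_left hAD
  have hQ : ∀ Q ∈ cliquesIn Γ m S, v ∈ Q → Q ⊆ A ∪ B := by
    intro Q hQ hvQ u hu
    obtain ⟨⟨hQS, -⟩, hcl⟩ := mem_cliquesIn.1 hQ
    by_cases huv : u = v
    · subst huv
      exact Finset.mem_union_left _ (Finset.mem_insert_self _ _)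
    · have huN : u ∈ nbrsIn Γ S v := mem_nbrsIn.2 ⟨hQS hu, hcl hvQ hu (Ne.symm huv)⟩
      by_cases huD : u ∈ D
      · exact Finset.mem_union_left _
          (Finset.mem_insert_of_mem (Finset.mem_inter.2 ⟨huN, huD⟩))
      · exact Finset.mem_union_right _ (Finset.mem_sdiff.2 ⟨huN, huD⟩)
  have hinter : ∀ Q, Q ⊆ A ∪ B → Q ∩ D = Q ∩ A := by
    intro Q hQ
    ext u
    simp only [Finset.mem_inter, and_congr_right_iff]
    intro hu
    refine ⟨fun huD => ?_, fun h => hAD h⟩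
    rcases Finset.mem_union.1 (hQ hu) with h | h
    · exact h
    · exact absurd huD (Finset.mem_sdiff.1 h).2
  have hle : ∑ Q ∈ cliquesIn Γ m S with v ∈ Q, ((Q ∩ D).card : ℚ)⁻¹
      ≤ ∑ Q ∈ (A ∪ B).powersetCard m with v ∈ Q, ((Q ∩ A).card : ℚ)⁻¹ := by
    rw [Finset.sum_congr rfl fun Q h => by
      rw [hinter Q (hQ Q (Finset.mem_filter.1 h).1 (Finset.mem_filter.1 h).2)]]
    refine Finset.sum_le_sum_of_subset_of_nonneg ?_ fun _ _ _ => by positivity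
    intro Q h
    rw [Finset.mem_filter] at h ⊢
    exact ⟨Finset.mem_powersetCard.2 ⟨hQ Q h.1 h.2, (mem_cliquesIn.1 h.1).1.2⟩, h.2⟩
  have heq := sum_inv_card_inter_powersetCard hAB (Finset.mem_insert_self v _) m
  rw [hAcard] at heq
  refine hle.trans ?_
  rw [meetShare, le_div_iff₀ (by positivity), mul_comm]
  push_cast at heq
  rw [heq, show (nbrsIn Γ S v ∩ D).card + 1 + B.card = (nbrsIn Γ S v ∩ D).card + B.card + 1 by ring]

end Counting

section Paths

variable {V : Type*}

/-- The list `l` is a path of `G` inside `S`. -/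
structure IsPathIn (G : SimpleGraph V) (S : Finset V) (l : List V) : Prop where
  nodup : l.Nodup
  chain : l.IsChain G.Adj
  subset : ∀ x ∈ l, x ∈ S

/-- Every cycle of `G`, listed in cyclic order, has fewer than `k` vertices. -/
def CyclesShorter (G : SimpleGraph V) (k : ℕ) : Prop :=
  ∀ l : List V, l.Nodup → l.IsChain G.Adj →
    ∀ h : 0 < l.length, G.Adj l[0] l[l.length - 1] → 3 ≤ l.length → l.length < k

theorem IsPathIn.length_le {G : SimpleGraph V} {S : Finset V} {l : List V} (h : IsPathIn G S l) :
    l.length ≤ S.card := by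
  rw [← List.toFinset_card_of_nodup h.nodup]
  exact Finset.card_le_card fun x hx => h.subset x (List.mem_toFinset.1 hx)

theorem cons_reverse_take_append_drop {l : List V} {i : ℕ} (hi : i < l.length) :
    l[i] :: ((l.take i).reverse ++ l.drop (i + 1))
      = (l.take (i + 1)).reverse ++ l.drop (i + 1) := by
  rw [List.take_succ_eq_append_getElem hi, List.reverse_append, List.reverse_singleton,
    List.singleton_append, List.cons_append]

theorem take_reverse_take_append_drop_perm (l : List V) {j c : ℕ} (hjc : j ≤ c) :
    (((l.take j).reverse ++ l.drop j).take c).Perm (l.take c) := by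
  have h : (l.take j).length ≤ c := by rw [List.length_take]; omega
  have hl : l.take c = l.take j ++ (l.drop j).take (c - (l.take j).length) := by
    conv_lhs => rw [← List.take_append_drop j l, List.take_append, List.take_of_length_le h]
  rw [hl, List.take_append, List.length_reverse,
    List.take_of_length_le (by rwa [List.length_reverse])]
  exact (List.reverse_perm _).append_right _

theorem IsPathIn.rotate {G : SimpleGraph V} {S : Finset V} {l : List V} (h : IsPathIn G S l)
    {i : ℕ} (hi : i + 1 < l.length) (hadj : G.Adj l[0] l[i + 1]) :
    IsPathIn G S (l[i] :: ((l.take i).reverse ++ l.drop (i + 1))) := by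
  rw [cons_reverse_take_append_drop (by omega)]
  have hperm : ((l.take (i + 1)).reverse ++ l.drop (i + 1)).Perm l := by
    conv_rhs => rw [← List.take_append_drop (i + 1) l]
    exact (List.reverse_perm _).append_right _
  refine ⟨hperm.nodup_iff.2 h.nodup, ?_, fun x hx => h.subset x (hperm.mem_iff.1 hx)⟩
  rw [List.isChain_append, List.isChain_reverse]
  refine ⟨(h.chain.take _).imp fun _ _ h => h.symm, h.chain.drop _, ?_⟩
  intro x hx y hy
  rw [List.getLast?_reverse, List.head?_take] at hx
  rw [List.head?_drop] at hy
  simp only [Nat.add_eq_zero_iff, one_ne_zero, and_false, if_false, Option.mem_def,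
    List.head?_eq_getElem?, List.getElem?_eq_getElem (show 0 < l.length by omega),
    Option.some.injEq] at hx
  simp only [List.getElem?_eq_getElem hi, Option.mem_def, Option.some.injEq] at hy
  subst hx hy
  exact hadj

theorem exists_max_of_bounded {P : ℕ → Prop} {b : ℕ} (hP : ∃ m, P m) (hb : ∀ m, P m → m ≤ b) :
    ∃ m, P m ∧ ∀ j, P j → j ≤ m := by
  obtain ⟨m, hm⟩ := hP
  exact ⟨Nat.findGreatest P b, Nat.findGreatest_spec (hb m hm) hm,
    fun j hj => Nat.le_findGreatest (hb j hj) hj⟩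

/-- In a graph without long cycles some nonempty vertex set `D` has all its neighbours in a small
set `W` containing it, and the vertices of `D` have degree at most `|D|`. -/
theorem exists_closed_rotation_set {G : SimpleGraph V} {k : ℕ} (hk : 3 ≤ k)
    (hG : CyclesShorter G k) {S : Finset V} {u w : V} (hu : u ∈ S) (hw : w ∈ S) (huw : G.Adj u w) :
    ∃ D W : Finset V, D.Nonempty ∧ D ⊆ S ∧ D.card < S.card ∧ D ⊆ W ∧ D.card + 2 ≤ k ∧
      W.card + 1 ≤ k ∧ ∀ v ∈ D, nbrsIn G S v ⊆ W ∧ (nbrsIn G S v).card ≤ D.card := by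
  obtain ⟨m, ⟨l₀, hl₀, hm₀⟩, hmax⟩ := exists_max_of_bounded
    (P := fun m => ∃ l, IsPathIn G S l ∧ l.length = m) (b := S.card)
    ⟨_, [], ⟨by simp, by simp, by simp⟩, rfl⟩
    (by rintro m ⟨l, hl, rfl⟩; exact hl.length_le)
  have hm2 : 2 ≤ m := by
    refine hmax 2 ⟨[u, w], ⟨by simpa using huw.ne, by simpa using huw, ?_⟩, rfl⟩
    simp [hu, hw]
  obtain ⟨d, ⟨x₀, t₀, hp₀, hlen₀, hd₀⟩, hdmax⟩ := exists_max_of_bounded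
    (P := fun d => ∃ x t, IsPathIn G S (x :: t) ∧ (x :: t).length = m ∧ (nbrsIn G S x).card = d)
    (b := S.card)
    (by
      obtain ⟨x, t, rfl⟩ := List.exists_cons_of_ne_nil (l := l₀) (by rintro rfl; simp at hm₀; omega)
      exact ⟨_, x, t, hl₀, hm₀, rfl⟩)
    (by rintro d ⟨x, t, -, -, rfl⟩; exact Finset.card_le_card (Finset.filter_subset _ _))
  have hmem : ∀ x t, IsPathIn G S (x :: t) → (x :: t).length = m → ∀ y ∈ nbrsIn G S x,
      ∃ (i : ℕ) (hi : i + 1 < (x :: t).length), i + 2 < k ∧ (x :: t)[i + 1] = y := by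
    intro x t hp hlen y hy
    rw [mem_nbrsIn] at hy
    have hyt : y ∈ t := by
      by_contra hyt
      have := hmax _ ⟨y :: x :: t, ⟨List.nodup_cons.2 ⟨?_, hp.nodup⟩,
        List.isChain_cons_cons.2 ⟨hy.2.symm, hp.chain⟩, ?_⟩, rfl⟩
      · rw [List.length_cons] at this
        omega
      · rw [List.mem_cons, not_or]
        exact ⟨hy.2.ne', hyt⟩
      · intro z hz
        rcases List.mem_cons.1 hz with rfl | hz
        · exact hy.1
        · exact hp.subset z hz
    obtain ⟨i, hi, rfl⟩ := List.mem_iff_getElem.1 hyt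
    refine ⟨i, by simpa using hi, ?_, by simp⟩
    rcases Nat.eq_zero_or_pos i with rfl | hpos
    · omega
    have hlen : ((x :: t).take (i + 2)).length = i + 2 := by
      rw [List.length_take, List.length_cons]; omega
    have := hG ((x :: t).take (i + 2)) (hp.nodup.sublist (List.take_sublist _ _))
      (hp.chain.take _) (by omega)
      (by
        simp only [hlen]
        simpa using hy.2) (by omega)
    omega
  set l := x₀ :: t₀ with hl
  set W := (l.take (k - 1)).toFinset with hW
  have hdx : ∀ y ∈ nbrsIn G S x₀, ∃ (i : ℕ) (hi : i + 1 < l.length), i + 2 < k ∧ l[i + 1] = y :=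
    hmem x₀ t₀ hp₀ hlen₀
  choose! f hf hfk hfy using hdx
  set D : Finset V := (nbrsIn G S x₀).attach.image fun y => l[f y.1]'(by
    have := hf y.1 y.2; omega) with hD
  have hDcard : D.card = d := by
    rw [hD, Finset.card_image_of_injective, Finset.card_attach, hd₀]
    rintro ⟨y, hy⟩ ⟨z, hz⟩ hyz
    have := (hp₀.nodup.getElem_inj_iff).1 hyz
    simp only [Subtype.mk.injEq]
    rw [← hfy y hy, ← hfy z hz]
    congr 2
  have hWcard : W.card + 1 ≤ k := by
    have := List.toFinset_card_le (l.take (k - 1))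
    rw [List.length_take, ← hW] at this
    omega
  have hDW : D ⊆ W := by
    intro v hv
    obtain ⟨⟨y, hy⟩, -, rfl⟩ := Finset.mem_image.1 hv
    have h1 := hf y hy
    have h2 := hfk y hy
    rw [hW, List.mem_toFinset, List.mem_take_iff_getElem]
    exact ⟨f y, by omega, rfl⟩
  have hDS : D ⊆ S := by
    intro v hv
    obtain ⟨⟨y, hy⟩, -, rfl⟩ := Finset.mem_image.1 hv
    exact hp₀.subset _ (List.getElem_mem _)
  have hx₀ : x₀ ∉ nbrsIn G S x₀ := fun h => (mem_nbrsIn.1 h).2.ne rfl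
  refine ⟨D, W, ?_, hDS, ?_, hDW, ?_, hWcard, ?_⟩
  · have h1 : 1 < l.length := by omega
    have hadj : G.Adj x₀ l[1] := by
      have := List.isChain_iff_getElem.1 hp₀.chain 0 h1
      simpa [hl] using this
    have : l[1] ∈ nbrsIn G S x₀ := mem_nbrsIn.2 ⟨hp₀.subset _ (List.getElem_mem _), hadj⟩
    rw [← Finset.card_pos, hDcard, ← hd₀]
    exact Finset.card_pos.2 ⟨_, this⟩
  · rw [hDcard, ← hd₀]
    refine Finset.card_lt_card ((Finset.ssubset_iff_of_subset (Finset.filter_subset _ _)).2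
      ⟨x₀, hp₀.subset _ (by simp [hl]), hx₀⟩)
  · have hsub : insert x₀ (nbrsIn G S x₀) ⊆ W := by
      intro y hy
      rw [hW, List.mem_toFinset, List.mem_take_iff_getElem]
      rcases Finset.mem_insert.1 hy with rfl | hy
      · exact ⟨0, by omega, by simp [hl]⟩
      · have h1 := hf y hy
        have h2 := hfk y hy
        exact ⟨f y + 1, by omega, hfy y hy⟩
    have := Finset.card_le_card hsub
    rw [Finset.card_insert_of_notMem hx₀, hd₀] at this
    omega
  · intro v hv
    obtain ⟨⟨y, hy⟩, -, rfl⟩ := Finset.mem_image.1 hv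
    have h1 := hf y hy
    have h2 := hfk y hy
    have hadj : G.Adj l[0] l[f y + 1] := by
      rw [hfy y hy]
      simpa [hl] using (mem_nbrsIn.1 hy).2
    have hrot := hp₀.rotate h1 hadj
    have hrotlen : (l[f y] :: ((l.take (f y)).reverse ++ l.drop (f y + 1))).length = m := by
      simp only [List.length_cons, List.length_append, List.length_reverse, List.length_take,
        List.length_drop]
      omega
    refine ⟨fun z hz => ?_, ?_⟩
    · obtain ⟨i, hi, hik, hiz⟩ := hmem _ _ hrot hrotlen z hz
      have hin : z ∈ (l[f y] :: ((l.take (f y)).reverse ++ l.drop (f y + 1))).take (k - 1) :=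
        List.mem_take_iff_getElem.2 ⟨i + 1, by omega, hiz⟩
      rw [cons_reverse_take_append_drop (by omega)] at hin
      rw [hW, List.mem_toFinset]
      exact (take_reverse_take_append_drop_perm l (by omega)).mem_iff.1 hin
    · rw [hDcard]
      exact hdmax _ ⟨_, _, hrot, hrotlen, rfl⟩

end Paths

section Main

variable {V : Type*}

/-- A graph whose edges are split into `B` and `R` and that has no cycle with `k` or more vertices:
the `r`-cliques of `B` plus the edges of `R` number at most `(|S| - 1) / (k - 2) * C(k - 1, r)`. -/
theorem card_cliquesIn_add_card_cliquesIn_le {B R : SimpleGraph V} (hBR : Disjoint B R) {r k : ℕ}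
    (hr : 3 ≤ r) (hk : r + 3 ≤ k) (hG : CyclesShorter (B ⊔ R) k) (S : Finset V)
    (hS : S.Nonempty) :
    ((k : ℚ) - 2) * ((cliquesIn B r S).card + (cliquesIn R 2 S).card)
      ≤ ((S.card : ℚ) - 1) * (k - 1).choose r := by
  induction S using Finset.strongInduction with
  | H S ih =>
  have hScard : (1 : ℚ) ≤ S.card := by exact_mod_cast hS.card_pos
  by_cases hedge : ∃ u ∈ S, ∃ w ∈ S, (B ⊔ R).Adj u w
  swap
  · have hempty : ∀ (Γ : SimpleGraph V) (m : ℕ), Γ ≤ B ⊔ R → 2 ≤ m → cliquesIn Γ m S = ∅ := by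
      intro Γ m hΓ hm
      rw [Finset.eq_empty_iff_forall_notMem]
      intro Q hQ
      obtain ⟨⟨hQS, hQm⟩, hcl⟩ := mem_cliquesIn.1 hQ
      obtain ⟨u, hu, w, hw, huw⟩ := Finset.one_lt_card.1 (show 1 < Q.card by omega)
      exact hedge ⟨u, hQS hu, w, hQS hw, hΓ (hcl hu hw huw)⟩
    rw [hempty B r le_sup_left (by omega), hempty R 2 le_sup_right le_rfl]
    simp only [Finset.card_empty, Nat.cast_zero, add_zero, mul_zero]
    exact mul_nonneg (by linarith) (Nat.cast_nonneg _)
  obtain ⟨u, hu, w, hw, huw⟩ := hedge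
  obtain ⟨D, W, hD, hDS, hDlt, hDW, hDk, hWk, hDn⟩ :=
    exists_closed_rotation_set (by omega) hG hu hw huw
  have hsd : (S \ D).card = S.card - D.card := Finset.card_sdiff_of_subset hDS
  have hrest := ih (S \ D) (Finset.sdiff_ssubset hDS hD) (Finset.card_pos.1 (by omega))
  have hlocal : ∀ v ∈ D, ((k : ℚ) - 2) *
      (∑ Q ∈ cliquesIn B r S with v ∈ Q, ((Q ∩ D).card : ℚ)⁻¹
        + ∑ Q ∈ cliquesIn R 2 S with v ∈ Q, ((Q ∩ D).card : ℚ)⁻¹) ≤ (k - 1).choose r := by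
    intro v hv
    obtain ⟨hvW, hvD⟩ := hDn v hv
    have hdisj : Disjoint (nbrsIn B S v) (nbrsIn R S v) := by
      rw [Finset.disjoint_left]
      intro x hx hx'
      exact (SimpleGraph.disjoint_left.1 hBR) v x (mem_nbrsIn.1 hx).2 (mem_nbrsIn.1 hx').2
    have hunion : nbrsIn (B ⊔ R) S v = nbrsIn B S v ∪ nbrsIn R S v := by
      ext x
      simp only [Finset.mem_union, mem_nbrsIn, SimpleGraph.sup_adj]
      tauto
    have hin : (nbrsIn B S v ∩ D).card + (nbrsIn R S v ∩ D).card
        = (nbrsIn (B ⊔ R) S v ∩ D).card := by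
      rw [hunion, Finset.union_inter_distrib_right, Finset.card_union_of_disjoint
        (hdisj.mono Finset.inter_subset_left Finset.inter_subset_left)]
    have hout : (nbrsIn B S v \ D).card + (nbrsIn R S v \ D).card
        = (nbrsIn (B ⊔ R) S v \ D).card := by
      rw [hunion, Finset.union_sdiff_distrib, Finset.card_union_of_disjoint
        (hdisj.mono Finset.sdiff_subset Finset.sdiff_subset)]
    have hlt : (nbrsIn (B ⊔ R) S v ∩ D).card < D.card :=
      Finset.card_lt_card ((Finset.ssubset_iff_of_subset Finset.inter_subset_right).2
        ⟨v, hv, fun h => (mem_nbrsIn.1 (Finset.mem_inter.1 h).1).2.ne rfl⟩)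
    have hle : (nbrsIn (B ⊔ R) S v \ D).card ≤ W.card - D.card := by
      rw [← Finset.card_sdiff_of_subset hDW]
      exact Finset.card_le_card (Finset.sdiff_subset_sdiff hvW le_rfl)
    have hsum := Finset.card_inter_add_card_sdiff (nbrsIn (B ⊔ R) S v) D
    have hDWcard := Finset.card_le_card hDW
    have hshare := meetShare_add_meetShare_le (r := r) (N := k - 1)
      (a := (nbrsIn B S v ∩ D).card) (b := (nbrsIn B S v \ D).card)
      (a' := (nbrsIn R S v ∩ D).card) (b' := (nbrsIn R S v \ D).card)
      hr (by omega) (by omega) (by omega)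
    have hk1 : ((k - 1 : ℕ) : ℚ) - 1 = k - 2 := by
      rw [Nat.cast_sub (by omega)]
      push_cast
      ring
    rw [hk1] at hshare
    have hk2 : (0 : ℚ) ≤ (k : ℚ) - 2 := by
      have : (2 : ℚ) ≤ k := by exact_mod_cast (by omega)
      linarith
    exact (mul_le_mul_of_nonneg_left (add_le_add (sum_inv_card_inter_cliquesIn_le B r S hv)
      (sum_inv_card_inter_cliquesIn_le R 2 S hv)) hk2).trans hshare
  have htouch := Finset.sum_le_sum hlocal
  rw [← Finset.mul_sum, Finset.sum_add_distrib, Finset.sum_const, nsmul_eq_mul] at htouch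
  rw [hsd, Nat.cast_sub hDlt.le] at hrest
  rw [card_cliquesIn B r S D, card_cliquesIn R 2 S D]
  linarith

/-- The pairs contained in some member of the family `X`. -/
noncomputable def shadowPairs (X : Finset (Finset V)) : Finset (Finset V) :=
  X.biUnion fun e => e.powersetCard 2

theorem mem_shadowPairs {X : Finset (Finset V)} {p : Finset V} :
    p ∈ shadowPairs X ↔ ∃ e ∈ X, p ⊆ e ∧ p.card = 2 := by
  simp only [shadowPairs, Finset.mem_biUnion, Finset.mem_powersetCard]

/-- A subfamily `X` of maximum deficiency: its shadow can be matched into `X`, and the remaining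
members of `H` can be matched to pairs outside of that shadow. -/
theorem exists_shadow_matching (H : Finset (Finset V)) :
    ∃ X ⊆ H, ∃ P : Finset (Finset V), Disjoint (shadowPairs X) P ∧ (H \ X).card = P.card ∧
      ∃ g : Finset V → Finset V, Set.InjOn g (shadowPairs X ∪ P : Finset (Finset V)) ∧
        ∀ p ∈ shadowPairs X ∪ P, p.card = 2 ∧ p ⊆ g p ∧ g p ∈ H := by
  obtain ⟨X, hXH, hX⟩ := Finset.exists_max_image H.powerset
    (fun X => (X.card : ℤ) - (shadowPairs X).card) ⟨∅, by simp⟩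
  rw [Finset.mem_powerset] at hXH
  have hX : ∀ Y ⊆ H, (Y.card : ℤ) - (shadowPairs Y).card ≤ X.card - (shadowPairs X).card :=
    fun Y hY => hX Y (Finset.mem_powerset.2 hY)
  obtain ⟨f, hf, hfmem⟩ := (Finset.all_card_le_biUnion_card_iff_exists_injective
    (fun e : ↥(H \ X) => e.1.powersetCard 2 \ shadowPairs X)).1 (by
      intro Y
      have hYX : Disjoint X (Y.map (Function.Embedding.subtype _)) := by
        rw [Finset.disjoint_right]
        intro e he
        obtain ⟨e', -, rfl⟩ := Finset.mem_map.1 he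
        exact (Finset.mem_sdiff.1 e'.2).2
      have hsub : X ∪ Y.map (Function.Embedding.subtype _) ⊆ H := by
        refine Finset.union_subset hXH fun e he => ?_
        obtain ⟨e', -, rfl⟩ := Finset.mem_map.1 he
        exact (Finset.mem_sdiff.1 e'.2).1
      have h := hX _ hsub
      have hshadow : shadowPairs (X ∪ Y.map (Function.Embedding.subtype _)) ⊆
          shadowPairs X ∪ Y.biUnion fun e => e.1.powersetCard 2 \ shadowPairs X := by
        intro p hp
        by_cases hpX : p ∈ shadowPairs X
        · exact Finset.mem_union_left _ hpX
        obtain ⟨e, he, hpe⟩ := mem_shadowPairs.1 hp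
        rcases Finset.mem_union.1 he with he | he
        · exact absurd (mem_shadowPairs.2 ⟨e, he, hpe⟩) hpX
        · obtain ⟨e', he', rfl⟩ := Finset.mem_map.1 he
          exact Finset.mem_union_right _ (Finset.mem_biUnion.2
            ⟨e', he', Finset.mem_sdiff.2 ⟨Finset.mem_powersetCard.2 hpe, hpX⟩⟩)
      have h1 := (Finset.card_le_card hshadow).trans (Finset.card_union_le _ _)
      rw [Finset.card_union_of_disjoint hYX, Finset.card_map] at h
      omega)
  obtain ⟨g₁, hg₁, hg₁mem⟩ := (Finset.all_card_le_biUnion_card_iff_exists_injective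
    (fun p : ↥(shadowPairs X) => {e ∈ X | p.1 ⊆ e})).1 (by
      intro Q
      set N := Q.biUnion fun p => {e ∈ X | p.1 ⊆ e} with hN
      have hNX : N ⊆ X := by
        intro e he
        obtain ⟨p, -, he⟩ := Finset.mem_biUnion.1 he
        exact (Finset.mem_filter.1 he).1
      have h := hX (X \ N) (Finset.sdiff_subset.trans hXH)
      have hQsub : Q.map (Function.Embedding.subtype _) ⊆ shadowPairs X := by
        intro p hp
        obtain ⟨p', -, rfl⟩ := Finset.mem_map.1 hp
        exact p'.2
      have hshadow : shadowPairs (X \ N) ⊆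
          shadowPairs X \ Q.map (Function.Embedding.subtype _) := by
        intro p hp
        obtain ⟨e, he, hpe⟩ := mem_shadowPairs.1 hp
        rw [Finset.mem_sdiff] at he
        refine Finset.mem_sdiff.2 ⟨mem_shadowPairs.2 ⟨e, he.1, hpe⟩, fun hpQ => he.2 ?_⟩
        obtain ⟨p', hp', rfl⟩ := Finset.mem_map.1 hpQ
        exact Finset.mem_biUnion.2 ⟨p', hp', Finset.mem_filter.2 ⟨he.1, hpe.1⟩⟩
      have h1 := Finset.card_le_card hshadow
      have h2 := Finset.card_le_card hQsub
      have h3 := Finset.card_le_card hNX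
      rw [Finset.card_sdiff_of_subset hQsub] at h1
      rw [Finset.card_sdiff_of_subset hNX] at h
      rw [Finset.card_map] at h1 h2
      omega)
  have hfX : ∀ e, f e ∉ shadowPairs X := fun e => (Finset.mem_sdiff.1 (hfmem e)).2
  have hfe : ∀ e, f e ⊆ e.1 ∧ (f e).card = 2 := fun e =>
    Finset.mem_powersetCard.1 (Finset.mem_sdiff.1 (hfmem e)).1
  have hg₁X : ∀ p, g₁ p ∈ X ∧ p.1 ⊆ g₁ p := fun p => Finset.mem_filter.1 (hg₁mem p)
  set P := (H \ X).attach.image f with hP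
  have hPmem : ∀ p ∈ P, ∃ e, f e = p := fun p hp => by
    obtain ⟨e, -, he⟩ := Finset.mem_image.1 hp
    exact ⟨e, he⟩
  refine ⟨X, hXH, P, ?_, ?_, fun p => if h : p ∈ shadowPairs X then g₁ ⟨p, h⟩ else
    if h : ∃ e, f e = p then h.choose.1 else p, ?_, ?_⟩
  · rw [Finset.disjoint_right]
    intro p hp
    obtain ⟨e, rfl⟩ := hPmem p hp
    exact hfX e
  · rw [hP, Finset.card_image_of_injective _ hf, Finset.card_attach]
  · intro p hp q hq hpq
    rw [Finset.mem_coe, Finset.mem_union] at hp hq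
    dsimp only at hpq
    by_cases hpX : p ∈ shadowPairs X <;> by_cases hqX : q ∈ shadowPairs X
    · rw [dif_pos hpX, dif_pos hqX] at hpq
      exact congrArg Subtype.val (hg₁ hpq)
    · have hq' := hPmem q (hq.resolve_left hqX)
      rw [dif_pos hpX, dif_neg hqX, dif_pos hq'] at hpq
      exact absurd (hpq ▸ (hg₁X ⟨p, hpX⟩).1) (Finset.mem_sdiff.1 hq'.choose.2).2
    · have hp' := hPmem p (hp.resolve_left hpX)
      rw [dif_neg hpX, dif_pos hqX, dif_pos hp'] at hpq
      exact absurd (hpq ▸ (hg₁X ⟨q, hqX⟩).1) (Finset.mem_sdiff.1 hp'.choose.2).2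
    · have hp' := hPmem p (hp.resolve_left hpX)
      have hq' := hPmem q (hq.resolve_left hqX)
      rw [dif_neg hpX, dif_pos hp', dif_neg hqX, dif_pos hq'] at hpq
      rw [← hp'.choose_spec, ← hq'.choose_spec, Subtype.ext hpq]
  · intro p hp
    rw [Finset.mem_union] at hp
    dsimp only
    by_cases hpX : p ∈ shadowPairs X
    · rw [dif_pos hpX]
      obtain ⟨e, -, -, hp2⟩ := mem_shadowPairs.1 hpX
      exact ⟨hp2, (hg₁X ⟨p, hpX⟩).2, hXH (hg₁X ⟨p, hpX⟩).1⟩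
    · have hp' := hPmem p (hp.resolve_left hpX)
      rw [dif_neg hpX, dif_pos hp']
      have hspec := hfe hp'.choose
      rw [hp'.choose_spec] at hspec
      exact ⟨hspec.2, hspec.1, (Finset.mem_sdiff.1 hp'.choose.2).1⟩

/-- The graph whose edges are the two-element members of `P`. -/
def pairGraph (P : Finset (Finset V)) : SimpleGraph V where
  Adj x y := x ≠ y ∧ {x, y} ∈ P
  symm := ⟨fun x y h => ⟨h.1.symm, by rw [Finset.pair_comm]; exact h.2⟩⟩
  loopless := ⟨fun _ h => h.1 rfl⟩

theorem cyclesShorter_of_bergeCycle_isEmpty {H P Q : Finset (Finset V)} {k : ℕ}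
    (hcyc : ∀ t, k ≤ t → IsEmpty (BergeCycle H t)) {g : Finset V → Finset V}
    (hg : Set.InjOn g (P ∪ Q : Finset (Finset V)))
    (hgH : ∀ p ∈ P ∪ Q, p ⊆ g p ∧ g p ∈ H) :
    CyclesShorter (pairGraph P ⊔ pairGraph Q) k := by
  intro l hnodup hchain hpos hclose hlen
  by_contra! hk
  have hmod : ∀ i : Fin l.length, (i.val + 1) % l.length < l.length := fun i => Nat.mod_lt _ i.pos
  have hadj : ∀ i : Fin l.length,
      (pairGraph P ⊔ pairGraph Q).Adj l[i.val] (l[(i.val + 1) % l.length]'(hmod i)) := by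
    intro i
    rcases Nat.lt_or_ge (i.val + 1) l.length with h | h
    · simp only [Nat.mod_eq_of_lt h]
      exact List.isChain_iff_getElem.1 hchain i.val h
    · have hi : i.val = l.length - 1 := by omega
      have hz : (i.val + 1) % l.length = 0 := by
        rw [hi, Nat.sub_add_cancel hpos, Nat.mod_self]
      simp only [hz]
      simp only [hi]
      exact hclose.symm
  have hmem : ∀ i : Fin l.length,
      ({l[i.val], l[(i.val + 1) % l.length]'(hmod i)} : Finset V) ∈ P ∪ Q := by
    intro i
    rcases hadj i with h | h
    · exact Finset.mem_union_left _ h.2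
    · exact Finset.mem_union_right _ h.2
  refine (hcyc l.length hk).false
    { verts := fun i => l[i.val]
      edges := fun i => g {l[i.val], l[(i.val + 1) % l.length]'(hmod i)}
      verts_inj := fun i j h => Fin.ext ((hnodup.getElem_inj_iff).1 h)
      edges_inj := ?_
      edges_mem := fun i => (hgH _ (hmem i)).2
      fst_mem := fun i => (hgH _ (hmem i)).1 (by simp)
      snd_mem := fun i => (hgH _ (hmem i)).1 (by simp) }
  intro i j hij
  have hpair := hg (Finset.mem_coe.2 (hmem i)) (Finset.mem_coe.2 (hmem j)) hij
  have hi : l[i.val] ∈ ({l[j.val], l[(j.val + 1) % l.length]'(hmod j)} : Finset V) := by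
    rw [← hpair]; simp
  have hj : l[j.val] ∈ ({l[i.val], l[(i.val + 1) % l.length]'(hmod i)} : Finset V) := by
    rw [hpair]; simp
  rw [Finset.mem_insert, Finset.mem_singleton, hnodup.getElem_inj_iff,
    hnodup.getElem_inj_iff] at hi hj
  rcases hi with hi | hi
  · exact Fin.ext hi
  rcases hj with hj | hj
  · exact Fin.ext hj.symm
  exfalso
  have hsucc : ∀ a : Fin l.length, (a.val + 1) % l.length = a.val + 1 ∨
      (a.val + 1 = l.length ∧ (a.val + 1) % l.length = 0) := by
    intro a
    rcases Nat.lt_or_ge (a.val + 1) l.length with h | h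
    · exact Or.inl (Nat.mod_eq_of_lt h)
    · have h' : a.val + 1 = l.length := by omega
      exact Or.inr ⟨h', by rw [h', Nat.mod_self]⟩
  have h1 := hsucc i
  have h2 := hsucc j
  omega

/-- The bound for hypergraphs on an arbitrary nonempty finite vertex type. -/
theorem card_le_of_bergeCycle_isEmpty [Fintype V] [Nonempty V] {r k : ℕ} (hr : 3 ≤ r)
    (hk : r + 3 ≤ k) {H : Finset (Finset V)} (huni : ∀ e ∈ H, e.card = r)
    (hcyc : ∀ t, k ≤ t → IsEmpty (BergeCycle H t)) :
    ((k : ℚ) - 2) * H.card ≤ ((Fintype.card V : ℚ) - 1) * (k - 1).choose r := by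
  obtain ⟨X, hXH, P, hdisj, hcard, g, hg, hgH⟩ := exists_shadow_matching H
  have hG := cyclesShorter_of_bergeCycle_isEmpty hcyc hg fun p hp => (hgH p hp).2
  have hBR : Disjoint (pairGraph (shadowPairs X)) (pairGraph P) :=
    SimpleGraph.disjoint_left.2 fun x y hx hy => Finset.disjoint_left.1 hdisj hx.2 hy.2
  have hX : X ⊆ cliquesIn (pairGraph (shadowPairs X)) r Finset.univ := by
    intro e he
    refine mem_cliquesIn.2 ⟨⟨Finset.subset_univ e, huni e (hXH he)⟩, fun x hx y hy hxy =>
      ⟨hxy, mem_shadowPairs.2 ⟨e, he, ?_, Finset.card_pair hxy⟩⟩⟩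
    exact Finset.insert_subset hx (Finset.singleton_subset_iff.2 hy)
  have hP : P ⊆ cliquesIn (pairGraph P) 2 Finset.univ := by
    intro p hp
    have hp2 := (hgH p (Finset.mem_union_right _ hp)).1
    refine mem_cliquesIn.2 ⟨⟨Finset.subset_univ p, hp2⟩, fun x hx y hy hxy => ⟨hxy, ?_⟩⟩
    rwa [Finset.eq_of_subset_of_card_le
      (Finset.insert_subset hx (Finset.singleton_subset_iff.2 hy))
      (by rw [hp2, Finset.card_pair hxy])]
  have hHcard : H.card = X.card + P.card := by
    rw [← hcard, add_comm]
    exact (Finset.card_sdiff_add_card_eq_card hXH).symm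
  have hmain := card_cliquesIn_add_card_cliquesIn_le hBR hr hk hG Finset.univ Finset.univ_nonempty
  have hk2 : (0 : ℚ) ≤ (k : ℚ) - 2 := by
    have : (2 : ℚ) ≤ k := by exact_mod_cast (by omega)
    linarith
  have hle : (H.card : ℚ) ≤ (cliquesIn (pairGraph (shadowPairs X)) r Finset.univ).card
      + (cliquesIn (pairGraph P) 2 Finset.univ).card := by
    exact_mod_cast hHcard.trans_le
      (Nat.add_le_add (Finset.card_le_card hX) (Finset.card_le_card hP))
  exact (mul_le_mul_of_nonneg_left hle hk2).trans hmain

end Main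

/-- Füredi–Kostochka–Luo. For `k ≥ r + 3 ≥ 6`, every `r`-uniform
hypergraph on `n` vertices with no Berge-cycle of length at least `k` has at most
`((n−1)/(k−2))·C(k−1, r)` hyperedges. -/
theorem furedi_kostochka_luo_cycles
    (n r k : ℕ) (hk : r + 3 ≤ k) (hr : 6 ≤ r + 3) (H : Finset (Finset (Fin n)))
    (huni : ∀ e ∈ H, e.card = r)
    (hcyc : ∀ t, k ≤ t → IsEmpty (BergeCycle H t)) :
    (k - 2) * H.card ≤ (n - 1) * (k - 1).choose r := by
  rcases Nat.eq_zero_or_pos n with rfl | hn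
  · have hH : H = ∅ := by
      rw [Finset.eq_empty_iff_forall_notMem]
      intro e he
      have h1 := huni e he
      rw [Finset.eq_empty_of_isEmpty e, Finset.card_empty] at h1
      omega
    simp [hH]
  have : Nonempty (Fin n) := ⟨⟨0, hn⟩⟩
  have hfinal := card_le_of_bergeCycle_isEmpty (by omega) hk huni hcyc
  rw [Fintype.card_fin] at hfinal
  have hgoal : (((k - 2) * H.card : ℕ) : ℚ) ≤ ((n - 1) * (k - 1).choose r : ℕ) := by
    rw [Nat.cast_mul, Nat.cast_mul, Nat.cast_sub (by omega : 2 ≤ k), Nat.cast_sub hn]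
    exact_mod_cast hfinal
  exact_mod_cast hgoal
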